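/- arXiv:2305.16271 — 2 statements merged into one kernel-verified Lean document; each statement's English description precedes it below -/
import Mathlib

section
/- Let 𝔽 be a field, let k₁, k₂ ≥ 1, and let A₁ be an invertible k₁×k₁ matrix over 𝔽 and A₂ an invertible k₂×k₂ matrix over 𝔽. Suppose that for every k₃ ≥ 1 and every invertible k₃×k₃ matrix A₃ over 𝔽 one has 2·k₁·k₃ − dim ker(A₁ ⊗ A₃⁻¹ − I) = 2·k₂·k₃ − dim ker(A₂ ⊗ A₃⁻¹ − I). Then k₁ = k₂ and A₁ is similar to A₂. -/
open Kronecker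

open Polynomial Module

universe u

section PolynomialModules

open Submodule

variable {F : Type u} [Field F]

/-- Multiplication by `a` on `F[X] ⧸ (b)` has kernel and cokernel of the same dimension. -/
theorem finrank_torsionBy_quotient_span (a b : F[X]) (hb : b ≠ 0) :
    finrank F (torsionBy F[X] (F[X] ⧸ Ideal.span {b}) a) =
      finrank F (F[X] ⧸ (Ideal.span {a} ⊔ Ideal.span {b})) := by
  have : FiniteDimensional F (F[X] ⧸ Ideal.span {b}) :=
    (AdjoinRoot.powerBasis hb).finite
  let g := DistribSMul.toLinearMap F[X] (F[X] ⧸ Ideal.span {b}) a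
  let f := g.restrictScalars F
  let q := g.range.mkQ ∘ₗ (Ideal.span {b}).mkQ
  have hq : Function.Surjective q := (mkQ_surjective _).comp (mkQ_surjective _)
  have hker : q.ker = Ideal.span {a} ⊔ Ideal.span {b} := by
    ext x
    rw [Ideal.mem_span_singleton_sup, LinearMap.mem_ker]
    simp only [q, LinearMap.comp_apply, mkQ_apply, Submodule.Quotient.mk_eq_zero,
      LinearMap.mem_range]
    constructor
    · rintro ⟨y, hy⟩
      obtain ⟨y, rfl⟩ := Submodule.Quotient.mk_surjective _ y
      have : (Submodule.Quotient.mk (a • y) : F[X] ⧸ Ideal.span {b}) =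
        Submodule.Quotient.mk x := hy
      rw [eq_comm, Submodule.Quotient.eq] at this
      exact ⟨y, _, this, by simp; ring⟩
    · rintro ⟨y, c, hc, rfl⟩
      refine ⟨Submodule.Quotient.mk y, ?_⟩
      change (Submodule.Quotient.mk (a • y) : F[X] ⧸ Ideal.span {b}) = _
      rw [Submodule.Quotient.eq]
      convert! (Ideal.span {b}).neg_mem hc using 1
      simp; ring
  have e := ((quotEquivOfEq _ _ hker.symm).trans
    (q.quotKerEquivOfSurjective hq)).restrictScalars F
  have h1 := f.finrank_range_add_finrank_ker
  have h2 := finrank_quotient_add_finrank f.range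
  rw [e.finrank_eq]
  change finrank F f.ker = finrank F (_ ⧸ f.range)
  omega

theorem finrank_torsionBy_quotient_span_pow {p q : F[X]} (hp : Irreducible p)
    (hq : Irreducible q) (n e : ℕ) [Decidable (Associated p q)] :
    finrank F (torsionBy F[X] (F[X] ⧸ Ideal.span {p ^ e}) (q ^ n)) =
      if Associated p q then q.natDegree * min n e else 0 := by
  rw [finrank_torsionBy_quotient_span _ _ (pow_ne_zero _ hp.ne_zero)]
  split_ifs with h
  · rw [Ideal.span_singleton_eq_span_singleton.2 (h.pow_pow (n := e))]
    rcases le_total n e with hle | hle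
    · rw [sup_of_le_left (Ideal.span_singleton_le_span_singleton.2 (pow_dvd_pow q hle)),
        finrank_quotient_span_eq_natDegree, natDegree_pow, min_eq_left hle, mul_comm]
    · rw [sup_of_le_right (Ideal.span_singleton_le_span_singleton.2 (pow_dvd_pow q hle)),
        finrank_quotient_span_eq_natDegree, natDegree_pow, min_eq_right hle, mul_comm]
  · have hc : IsCoprime (q ^ n) (p ^ e) :=
      (((hp.coprime_iff_not_dvd).2 fun hd ↦ h (hp.associated_of_dvd hq hd)).pow).symm
    have := (Ideal.isCoprime_span_singleton_iff _ _).2 hc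
    rw [Ideal.isCoprime_iff_sup_eq.1 this]
    exact finrank_zero_of_subsingleton

/-- The torsion submodule of a finite product is the product of the torsion submodules. -/
def torsionByPiEquiv {R ι : Type*} [CommRing R] (M : ι → Type*) [∀ i, AddCommGroup (M i)]
    [∀ i, Module R (M i)] (a : R) :
    torsionBy R (∀ i, M i) a ≃ₗ[R] ∀ i, torsionBy R (M i) a where
  toFun x i := ⟨x.1 i, congrFun x.2 i⟩
  invFun y := ⟨fun i ↦ (y i).1, funext fun i ↦ (y i).2⟩
  map_add' _ _ := rfl
  map_smul' _ _ := rfl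
  left_inv _ := rfl
  right_inv _ := rfl

/-- An `R`-linear equivalence restricts to the `a`-torsion submodules. -/
def torsionByCongr {R M N : Type*} [CommRing R] [AddCommGroup M] [Module R M] [AddCommGroup N]
    [Module R N] (f : M ≃ₗ[R] N) (a : R) : torsionBy R M a ≃ₗ[R] torsionBy R N a :=
  f.ofSubmodules _ _ <| by
    ext x
    simp only [mem_map, mem_torsionBy_iff]
    refine ⟨?_, fun h ↦ ⟨f.symm x, by rw [← map_smul, h, map_zero], f.apply_symm_apply x⟩⟩
    rintro ⟨y, hy, rfl⟩
    change a • f y = 0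
    rw [← map_smul, hy, map_zero]

open Classical in
theorem finrank_torsionBy_pi_quotient_span_pow {ι : Type*} [Fintype ι] {p : ι → F[X]}
    (hp : ∀ i, Irreducible (p i)) (e : ι → ℕ) {q : F[X]} (hq : Irreducible q) (n : ℕ) :
    finrank F (torsionBy F[X] (∀ i, F[X] ⧸ Ideal.span {p i ^ e i}) (q ^ n)) =
      q.natDegree * ∑ i, if Associated (p i) q then min n (e i) else 0 := by
  have (i : ι) : FiniteDimensional F (F[X] ⧸ Ideal.span {p i ^ e i}) :=
    (AdjoinRoot.powerBasis (pow_ne_zero _ (hp i).ne_zero)).finite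
  have (i : ι) : FiniteDimensional F (torsionBy F[X] (F[X] ⧸ Ideal.span {p i ^ e i}) (q ^ n)) :=
    inferInstanceAs (FiniteDimensional F
      ((torsionBy F[X] (F[X] ⧸ Ideal.span {p i ^ e i}) (q ^ n)).restrictScalars F))
  rw [((torsionByPiEquiv _ _).restrictScalars F).finrank_eq, finrank_pi_fintype, Finset.mul_sum]
  refine Finset.sum_congr rfl fun i _ ↦ ?_
  rw [finrank_torsionBy_quotient_span_pow (hp i) hq, mul_ite, mul_zero]

/-- Truncated sums determine the number of terms of each positive size. -/
theorem card_filter_eq_of_sum_min_eq {ι κ : Type u} [Fintype ι] [Fintype κ] (P : ι → Prop)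
    (Q : κ → Prop) [DecidablePred P] [DecidablePred Q] (e : ι → ℕ) (d : κ → ℕ)
    (h : ∀ n, (∑ i, if P i then min n (e i) else 0) = ∑ j, if Q j then min n (d j) else 0)
    (n : ℕ) :
    (Finset.univ.filter fun i ↦ P i ∧ e i = n + 1).card =
      (Finset.univ.filter fun j ↦ Q j ∧ d j = n + 1).card := by
  have key {α : Type u} [Fintype α] (P : α → Prop) [DecidablePred P] (e : α → ℕ) :
      (Finset.univ.filter fun i ↦ P i ∧ e i = n + 1).card +
        ((∑ i, if P i then min n (e i) else 0) + ∑ i, if P i then min (n + 2) (e i) else 0) =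
      2 * ∑ i, if P i then min (n + 1) (e i) else 0 := by
    rw [Finset.card_filter, Finset.mul_sum, ← Finset.sum_add_distrib, ← Finset.sum_add_distrib]
    refine Finset.sum_congr rfl fun i _ ↦ ?_
    split_ifs <;> grind
  have h1 := key P e
  have h2 := key Q d
  rw [h, h, h] at h1
  omega

theorem exists_equiv_pi_quotient_span_pow {M : Type*} [AddCommGroup M] [Module F[X] M]
    [Module.Finite F[X] M] (hM : IsTorsion F[X] M) :
    ∃ (ι : Type u) (_ : Fintype ι) (p : ι → F[X]) (_ : ∀ i, Irreducible (p i)) (e : ι → ℕ)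
      (_ : ∀ i, e i ≠ 0), Nonempty (M ≃ₗ[F[X]] ∀ i, F[X] ⧸ Ideal.span {p i ^ e i}) := by
  classical
  obtain ⟨ι, _, p, hp, e, ⟨f⟩⟩ := Module.equiv_directSum_of_isTorsion hM
  let r : (∀ i, F[X] ⧸ Ideal.span {p i ^ e i}) →ₗ[F[X]]
      ∀ i : {i // e i ≠ 0}, F[X] ⧸ Ideal.span {p i ^ e i} :=
    LinearMap.pi fun i ↦ LinearMap.proj i.1
  have hr : Function.Bijective r := by
    constructor
    · intro x y hxy
      ext i
      by_cases hi : e i = 0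
      · have : Subsingleton (F[X] ⧸ Ideal.span {p i ^ e i}) := by
          rw [hi, pow_zero, Ideal.span_singleton_one]
          infer_instance
        exact Subsingleton.elim _ _
      · exact congrFun hxy ⟨i, hi⟩
    · intro y
      refine ⟨fun i ↦ if hi : e i ≠ 0 then y ⟨i, hi⟩ else 0, ?_⟩
      ext i
      exact dif_pos i.2
  exact ⟨{i // e i ≠ 0}, inferInstance, fun i ↦ p i, fun i ↦ hp i, fun i ↦ e i, fun i ↦ i.2,
    ⟨f ≪≫ₗ DirectSum.linearEquivFunOnFintype _ _ _ ≪≫ₗ LinearEquiv.ofBijective r hr⟩⟩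

/-- Finitely generated torsion modules over `F[X]` are determined by the dimensions of their
torsion submodules with respect to powers of irreducible polynomials. -/
theorem nonempty_linearEquiv_of_finrank_torsionBy_eq {M N : Type*} [AddCommGroup M]
    [Module F[X] M] [Module.Finite F[X] M] [Module F M] [IsScalarTower F F[X] M]
    [AddCommGroup N] [Module F[X] N] [Module.Finite F[X] N] [Module F N]
    [IsScalarTower F F[X] N] (hM : IsTorsion F[X] M) (hN : IsTorsion F[X] N)
    (h : ∀ q : F[X], Irreducible q → ∀ n : ℕ,
      finrank F (torsionBy F[X] M (q ^ n)) = finrank F (torsionBy F[X] N (q ^ n))) :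
    Nonempty (M ≃ₗ[F[X]] N) := by
  classical
  obtain ⟨ι, _, p, hp, e, he, ⟨f⟩⟩ := exists_equiv_pi_quotient_span_pow hM
  obtain ⟨κ, _, r, hr, d, hd, ⟨g⟩⟩ := exists_equiv_pi_quotient_span_pow hN
  have hcard (q : F[X]) (hq : Irreducible q) (n : ℕ) :
      (Finset.univ.filter fun i ↦ Associated (p i) q ∧ e i = n + 1).card =
        (Finset.univ.filter fun j ↦ Associated (r j) q ∧ d j = n + 1).card := by
    refine card_filter_eq_of_sum_min_eq (fun i ↦ Associated (p i) q)
      (fun j ↦ Associated (r j) q) e d (fun m ↦ ?_) n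
    refine Nat.eq_of_mul_eq_mul_left hq.natDegree_pos ?_
    rw [← finrank_torsionBy_pi_quotient_span_pow hp e hq,
      ← finrank_torsionBy_pi_quotient_span_pow hr d hq,
      ← ((torsionByCongr f _).restrictScalars F).finrank_eq,
      ← ((torsionByCongr g _).restrictScalars F).finrank_eq, h q hq]
  let s (i : ι) : Ideal F[X] × ℕ := (Ideal.span {p i}, e i)
  let t (j : κ) : Ideal F[X] × ℕ := (Ideal.span {r j}, d j)
  have hst (c : Ideal F[X] × ℕ) : Nonempty ({i // s i = c} ≃ {j // t j = c}) := by
    rw [← Fintype.card_eq]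
    by_cases hc : ∃ q n, Irreducible q ∧ c = (Ideal.span {q}, n + 1)
    · obtain ⟨q, n, hq, rfl⟩ := hc
      simpa only [Fintype.card_subtype, s, t, Prod.mk.injEq,
        Ideal.span_singleton_eq_span_singleton] using hcard q hq n
    · have : IsEmpty {i // s i = c} := ⟨fun ⟨i, hi⟩ ↦
        hc ⟨p i, e i - 1, hp i, by rw [← hi, Nat.sub_add_cancel (Nat.pos_of_ne_zero (he i))]⟩⟩
      have : IsEmpty {j // t j = c} := ⟨fun ⟨j, hj⟩ ↦
        hc ⟨r j, d j - 1, hr j, by rw [← hj, Nat.sub_add_cancel (Nat.pos_of_ne_zero (hd j))]⟩⟩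
      simp
  let σ : ι ≃ κ := Equiv.ofFiberEquiv fun c ↦ (hst c).some
  have hσ (i : ι) : Ideal.span {p i ^ e i} = Ideal.span {r (σ i) ^ d (σ i)} := by
    have := Equiv.ofFiberEquiv_map (fun c ↦ (hst c).some) i
    obtain ⟨h1, h2⟩ := Prod.ext_iff.1 this
    change Ideal.span {r (σ i)} = Ideal.span {p i} at h1
    change d (σ i) = e i at h2
    rw [← Ideal.span_singleton_pow, ← Ideal.span_singleton_pow, h1, h2]
  exact ⟨f ≪≫ₗ LinearEquiv.piCongrRight (fun i ↦ quotEquivOfEq _ _ (hσ i)) ≪≫ₗ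
    LinearEquiv.piCongrLeft F[X] (fun j ↦ F[X] ⧸ Ideal.span {r j ^ d j}) σ ≪≫ₗ g.symm⟩

end PolynomialModules

section KroneckerKernel

variable {F m n : Type*} [Field F] [Fintype m] [Fintype n] [DecidableEq n]

theorem kronecker_inv_sub_one_mulVec_vec_eq_zero_iff [DecidableEq m] (A : Matrix m m F)
    {D : Matrix n n F} (hD : IsUnit D) (Y : Matrix n m F) :
    (A ⊗ₖ D⁻¹ - 1).mulVec Y.vec = 0 ↔ Y * A.transpose = D * Y := by
  have hdet := (Matrix.isUnit_iff_isUnit_det D).1 hD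
  rw [Matrix.sub_mulVec, Matrix.one_mulVec, Matrix.kronecker_mulVec_vec, sub_eq_zero,
    Matrix.vec_inj, Matrix.mul_assoc]
  constructor
  · intro h
    conv_rhs => rw [← h]
    rw [Matrix.mul_nonsing_inv_cancel_left _ _ hdet]
  · intro h
    rw [h, Matrix.nonsing_inv_mul_cancel_left _ _ hdet]

theorem isUnit_adjoinRoot_root {p : F[X]} (h0 : p.coeff 0 ≠ 0) : IsUnit (AdjoinRoot.root p) := by
  have h := congrArg (AdjoinRoot.mk p) (divX_mul_X_add p)
  rw [AdjoinRoot.mk_self, map_add, map_mul, AdjoinRoot.mk_X, AdjoinRoot.mk_C] at h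
  refine isUnit_of_mul_isUnit_right (x := AdjoinRoot.mk p p.divX) ?_
  rw [eq_neg_of_add_eq_zero_left h]
  exact ((isUnit_iff_ne_zero.2 h0).map (AdjoinRoot.of p)).neg

/-- A linear map that intertwines multiplication by the root with `A` is determined by its value
at `1`. -/
theorem apply_mk_of_intertwines [DecidableEq m] {p : F[X]} {A : Matrix m m F}
    {f : AdjoinRoot p →ₗ[F] (m → F)}
    (hf : ∀ r, f (AdjoinRoot.root p * r) = A.mulVec (f r)) (q : F[X]) :
    f (AdjoinRoot.mk p q) = (aeval A q).mulVec (f 1) := by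
  induction q using Polynomial.induction_on' with
  | add a b ha hb => rw [map_add, map_add, map_add, Matrix.add_mulVec, ha, hb]
  | monomial k c =>
    rw [← C_mul_X_pow_eq_monomial, ← smul_eq_C_mul, ← AdjoinRoot.smul_mk, map_smul, map_smul,
      Matrix.smul_mulVec, aeval_X_pow, map_pow, AdjoinRoot.mk_X]
    congr 1
    induction k with
    | zero => simp
    | succ k ih => rw [pow_succ', hf, ih, pow_succ', Matrix.mulVec_mulVec]

theorem exists_intertwines_of_mem_ker [DecidableEq m] {p : F[X]} {A : Matrix m m F}
    {x : m → F} (hx : (aeval A p).mulVec x = 0) :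
    ∃ f : AdjoinRoot p →ₗ[F] (m → F),
      f 1 = x ∧ ∀ r, f (AdjoinRoot.root p * r) = A.mulVec (f r) := by
  let g : F[X] →ₗ[F] (m → F) :=
    { toFun q := (aeval A q).mulVec x
      map_add' a b := by rw [map_add, Matrix.add_mulVec]
      map_smul' c a := by rw [map_smul, Matrix.smul_mulVec, RingHom.id_apply] }
  have hg : (Ideal.span {p}).restrictScalars F ≤ g.ker := by
    intro q hq
    obtain ⟨c, rfl⟩ := Ideal.mem_span_singleton'.1 hq
    change (aeval A (c * p)).mulVec x = 0
    rw [map_mul, ← Matrix.mulVec_mulVec, hx, Matrix.mulVec_zero]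
  let f : AdjoinRoot p →ₗ[F] (m → F) := ((Ideal.span {p}).restrictScalars F).liftQ g hg
  have hf (q : F[X]) : f (AdjoinRoot.mk p q) = (aeval A q).mulVec x := rfl
  refine ⟨f, ?_, fun r ↦ ?_⟩
  · rw [← map_one (AdjoinRoot.mk p), hf, map_one, Matrix.one_mulVec]
  · obtain ⟨q, rfl⟩ := AdjoinRoot.mk_surjective r
    rw [← AdjoinRoot.mk_X, ← map_mul, hf, hf, map_mul, aeval_X, Matrix.mulVec_mulVec]

/-- The transposed companion matrix of `p`. -/
noncomputable def transposedCompanion {p : F[X]} (hp : p.Monic) :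
    Matrix (Fin p.natDegree) (Fin p.natDegree) F :=
  (Algebra.leftMulMatrix (AdjoinRoot.powerBasisAux' hp) (AdjoinRoot.root p)).transpose

theorem isUnit_transposedCompanion {p : F[X]} (hp : p.Monic) (h0 : p.coeff 0 ≠ 0) :
    IsUnit (transposedCompanion hp) :=
  (Matrix.isUnit_transpose _).2 ((isUnit_adjoinRoot_root h0).map _)

theorem mul_transpose_eq_transposedCompanion_mul_iff {p : F[X]} (hp : p.Monic) (A : Matrix m m F)
    (f : AdjoinRoot p →ₗ[F] (m → F)) :
    (Matrix.of fun j ↦ f (AdjoinRoot.powerBasisAux' hp j)) * A.transpose =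
        transposedCompanion hp * (Matrix.of fun j ↦ f (AdjoinRoot.powerBasisAux' hp j)) ↔
      ∀ r, f (AdjoinRoot.root p * r) = A.mulVec (f r) := by
  set b := AdjoinRoot.powerBasisAux' hp with hb
  have hl (j) : ((Matrix.of fun j ↦ f (b j)) * A.transpose) j = A.mulVec (f (b j)) := by
    ext i
    simp [Matrix.mul_apply, Matrix.mulVec, dotProduct, mul_comm]
  have hr (j) : (transposedCompanion hp * (Matrix.of fun j ↦ f (b j))) j =
      f (AdjoinRoot.root p * b j) := by
    conv_rhs => rw [← b.sum_repr (AdjoinRoot.root p * b j), map_sum]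
    ext i
    simp [Matrix.mul_apply, transposedCompanion, ← hb, Algebra.leftMulMatrix_eq_repr_mul]
  constructor
  · intro h
    have : f ∘ₗ LinearMap.mulLeft F (AdjoinRoot.root p) = A.mulVecLin ∘ₗ f :=
      b.ext fun j ↦ by
        have := congrFun h j
        rw [hl, hr] at this
        exact this.symm
    exact fun r ↦ LinearMap.congr_fun this r
  · intro h
    funext j
    rw [hl, hr, h]

/-- Pairing with a companion matrix computes the dimension of the kernel of `p(A)`. -/
theorem finrank_ker_kronecker_transposedCompanion [DecidableEq m] {p : F[X]} (hp : p.Monic)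
    (h0 : p.coeff 0 ≠ 0) (A : Matrix m m F) :
    finrank F (A ⊗ₖ (transposedCompanion hp)⁻¹ - 1).mulVecLin.ker =
      finrank F (aeval A p).mulVecLin.ker := by
  let b := AdjoinRoot.powerBasisAux' hp
  let L : (m × Fin p.natDegree → F) →ₗ[F] (AdjoinRoot p →ₗ[F] (m → F)) :=
    (b.constr F).toLinearMap ∘ₗ
      LinearMap.pi fun j ↦ LinearMap.pi fun i ↦ LinearMap.proj (i, j)
  have hL (v) (j) (i) : L v (b j) i = v (i, j) := by simp [L, b.constr_basis]
  have hvec (v) : (Matrix.of fun j ↦ L v (b j)).vec = v := by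
    ext ⟨i, j⟩
    exact hL v j i
  have hmem (v) : v ∈ (A ⊗ₖ (transposedCompanion hp)⁻¹ - 1).mulVecLin.ker ↔
      ∀ r, L v (AdjoinRoot.root p * r) = A.mulVec (L v r) := by
    rw [LinearMap.mem_ker, Matrix.mulVecLin_apply]
    conv_lhs => rw [← hvec v]
    rw [kronecker_inv_sub_one_mulVec_vec_eq_zero_iff A (isUnit_transposedCompanion hp h0),
      mul_transpose_eq_transposedCompanion_mul_iff]
  let Φ : (A ⊗ₖ (transposedCompanion hp)⁻¹ - 1).mulVecLin.ker →ₗ[F]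
      (aeval A p).mulVecLin.ker :=
    LinearMap.codRestrict _ (LinearMap.applyₗ 1 ∘ₗ L ∘ₗ Submodule.subtype _) fun v ↦ by
      rw [LinearMap.mem_ker, Matrix.mulVecLin_apply]
      refine (apply_mk_of_intertwines ((hmem v).1 v.2) p).symm.trans ?_
      rw [AdjoinRoot.mk_self, map_zero]
  refine (LinearEquiv.ofBijective Φ ⟨?_, ?_⟩).finrank_eq
  · rw [← LinearMap.ker_eq_bot, LinearMap.ker_eq_bot']
    intro v hv
    have h1 : L v 1 = 0 := congrArg Subtype.val hv
    have h2 : L v = 0 := by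
      ext1 r
      obtain ⟨q, rfl⟩ := AdjoinRoot.mk_surjective r
      rw [apply_mk_of_intertwines ((hmem v).1 v.2), h1, Matrix.mulVec_zero, LinearMap.zero_apply]
    ext ⟨i, j⟩
    refine (hL v j i).symm.trans ?_
    rw [h2]
    rfl
  · rintro ⟨x, hx⟩
    obtain ⟨f, hf1, hf⟩ := exists_intertwines_of_mem_ker hx
    have hLf : L (fun ij ↦ f (b ij.2) ij.1) = f := b.ext fun j ↦ funext fun i ↦ hL _ j i
    refine ⟨⟨fun ij ↦ f (b ij.2) ij.1, (hmem _).2 (by rwa [hLf])⟩, Subtype.ext ?_⟩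
    exact (LinearMap.congr_fun hLf 1).trans hf1

end KroneckerKernel
section Similarity

variable {F : Type*} [Field F]

theorem finrank_ker_mulVecLin_eq_zero {k : ℕ} {B : Matrix (Fin k) (Fin k) F} (hB : IsUnit B) :
    finrank F B.mulVecLin.ker = 0 := by
  rw [LinearMap.ker_eq_bot.2 (Matrix.mulVec_injective_of_isUnit hB), finrank_bot]

theorem finrank_torsionBy_aeval_toLin' {k : ℕ} (A : Matrix (Fin k) (Fin k) F) (q : F[X]) :
    finrank F (Submodule.torsionBy F[X] (AEval' A.toLin') q) =
      finrank F (aeval A q).mulVecLin.ker := by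
  have haeval : aeval A.toLin' q = (aeval A q).toLin' :=
    aeval_algHom_apply (Matrix.toLinAlgEquiv' (R := F) (n := Fin k)) A q
  refine (LinearEquiv.ofSubmodules (AEval'.of A.toLin') (aeval A q).mulVecLin.ker
    ((Submodule.torsionBy F[X] (AEval' A.toLin') q).restrictScalars F) ?_).finrank_eq.symm
  ext y
  obtain ⟨x, rfl⟩ := (AEval'.of A.toLin').surjective y
  rw [Submodule.mem_map_equiv, LinearEquiv.symm_apply_apply, Submodule.restrictScalars_mem,
    Submodule.mem_torsionBy_iff, LinearMap.mem_ker]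
  change _ ↔ q • AEval.of F _ A.toLin' x = 0
  rw [← AEval.of_aeval_smul, LinearEquiv.map_eq_zero_iff, haeval]
  rfl

/-- Square matrices are similar if all polynomials in them have kernels of equal dimension. -/
theorem exists_conj_of_finrank_ker_aeval_eq {k : ℕ} (A B : Matrix (Fin k) (Fin k) F)
    (h : ∀ q : F[X], Irreducible q → ∀ n : ℕ, finrank F (aeval A (q ^ n)).mulVecLin.ker =
      finrank F (aeval B (q ^ n)).mulVecLin.ker) :
    ∃ P : Matrix (Fin k) (Fin k) F, IsUnit P ∧ A = P * B * P⁻¹ := by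
  obtain ⟨f⟩ := nonempty_linearEquiv_of_finrank_torsionBy_eq (F := F)
    (AEval.isTorsion_of_finiteDimensional F (Fin k → F) A.toLin')
    (AEval.isTorsion_of_finiteDimensional F (Fin k → F) B.toLin') fun q hq n ↦ by
      rw [finrank_torsionBy_aeval_toLin', finrank_torsionBy_aeval_toLin', h q hq n]
  let g : (Fin k → F) ≃ₗ[F] (Fin k → F) :=
    AEval'.of B.toLin' ≪≫ₗ (f.symm.restrictScalars F) ≪≫ₗ (AEval'.of A.toLin').symm
  have hg (x) : g (B.toLin' x) = A.toLin' (g x) := by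
    simp only [g, LinearEquiv.trans_apply]
    rw [← AEval'.X_smul_of, LinearEquiv.restrictScalars_apply, map_smul,
      AEval'.of_symm_X_smul, LinearEquiv.restrictScalars_apply]
  have hunit : IsUnit (LinearMap.toMatrix' g.toLinearMap) :=
    IsUnit.of_mul_eq_one (LinearMap.toMatrix' g.symm.toLinearMap) (by
      rw [← LinearMap.toMatrix'_comp, LinearEquiv.comp_symm, LinearMap.toMatrix'_id])
  refine ⟨_, hunit, ?_⟩
  have hcomm : LinearMap.toMatrix' g.toLinearMap * B = A * LinearMap.toMatrix' g.toLinearMap := by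
    apply Matrix.toLin'.injective
    rw [Matrix.toLin'_mul, Matrix.toLin'_mul, Matrix.toLin'_toMatrix']
    exact LinearMap.ext hg
  rw [hcomm, Matrix.mul_nonsing_inv_cancel_right _ _ ((Matrix.isUnit_iff_isUnit_det _).1 hunit)]

theorem charpoly_coeff_zero_ne_zero {k : ℕ} {A : Matrix (Fin k) (Fin k) F} (hA : IsUnit A) :
    A.charpoly.coeff 0 ≠ 0 := by
  intro h0
  have := ((Matrix.isUnit_iff_isUnit_det A).1 hA).ne_zero
  rw [Matrix.det_eq_sign_charpoly_coeff, h0, mul_zero] at this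
  exact this rfl

theorem finrank_ker_mulVecLin_zero (F : Type*) [Field F] (k : ℕ) :
    finrank F (0 : Matrix (Fin k) (Fin k) F).mulVecLin.ker = k := by
  rw [Matrix.mulVecLin_zero, LinearMap.ker_zero, finrank_top, finrank_fin_fun]

end Similarity

/-- If `A₁` and `A₂` are invertible matrices over a field `F` (of sizes `k₁ ≥ 1` and
`k₂ ≥ 1`) such that for every `k₃ ≥ 1` and every invertible `k₃ × k₃` matrix `A₃` one has
`2·k₁·k₃ − dim ker (A₁ ⊗ A₃⁻¹ − I) = 2·k₂·k₃ − dim ker (A₂ ⊗ A₃⁻¹ − I)`,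
then `k₁ = k₂` and `A₁` is similar to `A₂`. -/
theorem local_systems_distinguished_by_pairing
    (F : Type) [Field F] (k₁ k₂ : ℕ) (hk₁ : 1 ≤ k₁) (hk₂ : 1 ≤ k₂)
    (A₁ : Matrix (Fin k₁) (Fin k₁) F) (A₂ : Matrix (Fin k₂) (Fin k₂) F)
    (hA₁ : IsUnit A₁) (hA₂ : IsUnit A₂)
    (h : ∀ k₃ : ℕ, 1 ≤ k₃ → ∀ A₃ : Matrix (Fin k₃) (Fin k₃) F, IsUnit A₃ →
      (2 * k₁ * k₃ : ℤ) -
          (Module.finrank F (LinearMap.ker (Matrix.mulVecLin (A₁ ⊗ₖ A₃⁻¹ - 1))) : ℤ) =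
        (2 * k₂ * k₃ : ℤ) -
          (Module.finrank F (LinearMap.ker (Matrix.mulVecLin (A₂ ⊗ₖ A₃⁻¹ - 1))) : ℤ)) :
    ∃ (hk : k₁ = k₂) (P : Matrix (Fin k₂) (Fin k₂) F), IsUnit P ∧
      Matrix.reindex (finCongr hk) (finCongr hk) A₁ = P * A₂ * P⁻¹ := by
  classical
  have hmonic {p : F[X]} (hp : p.Monic) (h0 : p.coeff 0 ≠ 0) (hn : 1 ≤ p.natDegree) :
      (2 * k₁ * p.natDegree : ℤ) - finrank F (aeval A₁ p).mulVecLin.ker =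
        2 * k₂ * p.natDegree - finrank F (aeval A₂ p).mulVecLin.ker := by
    simpa only [finrank_ker_kronecker_transposedCompanion hp h0] using
      h p.natDegree hn (transposedCompanion hp) (isUnit_transposedCompanion hp h0)
  obtain rfl : k₁ = k₂ := by
    have hpos : 1 ≤ (A₁.charpoly * A₂.charpoly).natDegree := by
      rw [A₁.charpoly_monic.natDegree_mul A₂.charpoly_monic, A₁.charpoly_natDegree_eq_dim,
        Fintype.card_fin]
      omega
    have := hmonic (A₁.charpoly_monic.mul A₂.charpoly_monic)
      (by
        rw [mul_coeff_zero]
        exact mul_ne_zero (charpoly_coeff_zero_ne_zero hA₁) (charpoly_coeff_zero_ne_zero hA₂))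
      hpos
    rw [map_mul, map_mul, Matrix.aeval_self_charpoly, Matrix.aeval_self_charpoly, zero_mul,
      mul_zero, finrank_ker_mulVecLin_zero, finrank_ker_mulVecLin_zero] at this
    have hfactor : ((k₁ : ℤ) - k₂) * (2 * (A₁.charpoly * A₂.charpoly).natDegree - 1) = 0 := by
      linear_combination this
    rcases mul_eq_zero.1 hfactor with h' | h' <;> omega
  have hdim {p : F[X]} (h0 : p.coeff 0 ≠ 0) (hn : 1 ≤ p.natDegree) :
      finrank F (aeval A₁ p).mulVecLin.ker = finrank F (aeval A₂ p).mulVecLin.ker := by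
    have hp : p ≠ 0 := by
      rintro rfl
      exact h0 (coeff_zero 0)
    have hc : p.leadingCoeff⁻¹ ≠ 0 := inv_ne_zero (leadingCoeff_ne_zero.2 hp)
    have hker (A : Matrix (Fin k₁) (Fin k₁) F) :
        (aeval A (p * C p.leadingCoeff⁻¹)).mulVecLin.ker = (aeval A p).mulVecLin.ker := by
      ext x
      rw [mul_comm, ← smul_eq_C_mul, map_smul, LinearMap.mem_ker, LinearMap.mem_ker,
        Matrix.mulVecLin_apply, Matrix.mulVecLin_apply, Matrix.smul_mulVec,
        smul_eq_zero_iff_right hc]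
    have := hmonic (monic_mul_leadingCoeff_inv hp)
      (by
        rw [coeff_mul_C]
        exact mul_ne_zero h0 hc)
      (by rwa [natDegree_mul_C hc])
    rw [hker, hker] at this
    omega
  refine ⟨rfl, ?_⟩
  simp only [finCongr_refl, Matrix.reindex_refl_refl]
  refine exists_conj_of_finrank_ker_aeval_eq A₁ A₂ fun q hq n ↦ ?_
  by_cases hunit : n = 0 ∨ q.coeff 0 = 0
  · have hA {A : Matrix (Fin k₁) (Fin k₁) F} (hA : IsUnit A) : IsUnit (aeval A (q ^ n)) := by
      rcases hunit with rfl | h0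
      · simp
      · obtain ⟨u, rfl⟩ := irreducible_X.associated_of_dvd hq (X_dvd_iff.2 h0)
        rw [map_pow, map_mul, aeval_X]
        exact (hA.mul (u.isUnit.map _)).pow n
    rw [finrank_ker_mulVecLin_eq_zero (hA hA₁), finrank_ker_mulVecLin_eq_zero (hA hA₂)]
  · rw [not_or] at hunit
    refine hdim ?_ ?_
    · rw [coeff_zero_eq_eval_zero, eval_pow, ← coeff_zero_eq_eval_zero]
      exact pow_ne_zero _ hunit.2
    · rw [natDegree_pow]
      exact Nat.mul_pos (Nat.pos_of_ne_zero hunit.1) hq.natDegree_pos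
end

section
/- There exists a reduced matrix-model bigraded complex over the two-element field 𝔽₂ = ℤ/2ℤ that is not isomorphic, via a homogeneous change of basis, to any matrix-model bigraded complex that is simultaneously vertically simplified and horizontally simplified. -/
/-- A *matrix-model bigraded complex* over a field `F` with `m` generators: a bigrading
`gr = (grw, grz) : Fin m → ℤ × ℤ` with `grw i ≡ grz i (mod 2)`, and an `m × m` matrix `d`
over `F` with `d · d = 0` whose entry `d i j` vanishes unless `grw j - grw i` is odd and
both `grw j - grw i` and `grz j - grz i` are at least `-1`. -/
structure BigradedComplex (F : Type) [Field F] (m : ℕ) where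
  grw : Fin m → ℤ
  grz : Fin m → ℤ
  parity : ∀ i, grw i % 2 = grz i % 2
  d : Matrix (Fin m) (Fin m) F
  d_sq : d * d = 0
  d_supp : ∀ i j, d i j ≠ 0 →
    Odd (grw j - grw i) ∧ -1 ≤ grw j - grw i ∧ -1 ≤ grz j - grz i

namespace BigradedComplex

variable {F : Type} [Field F] {m m' : ℕ}

/-- A matrix-model bigraded complex is *reduced* if `d i j = 0` whenever
`grw j = grw i - 1` and `grz j = grz i - 1`. -/
def Reduced (C : BigradedComplex F m) : Prop :=
  ∀ i j, C.grw j = C.grw i - 1 → C.grz j = C.grz i - 1 → C.d i j = 0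

open Classical in
/-- A matrix-model bigraded complex is *vertically simplified* if each index `k` is
involved in at most one vertical arrow: the number of indices `j` with `d k j ≠ 0` and
`grw j = grw k - 1`, plus the number of indices `j` with `d j k ≠ 0` and
`grw k = grw j - 1`, is at most `1`. -/
def VerticallySimplified (C : BigradedComplex F m) : Prop :=
  ∀ k : Fin m,
    (Finset.univ.filter fun j => C.d k j ≠ 0 ∧ C.grw j = C.grw k - 1).card +
      (Finset.univ.filter fun j => C.d j k ≠ 0 ∧ C.grw k = C.grw j - 1).card ≤ 1

open Classical in
/-- A matrix-model bigraded complex is *horizontally simplified* if each index `k` is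
involved in at most one horizontal arrow: the number of indices `j` with `d k j ≠ 0` and
`grz j = grz k - 1`, plus the number of indices `j` with `d j k ≠ 0` and
`grz k = grz j - 1`, is at most `1`. -/
def HorizontallySimplified (C : BigradedComplex F m) : Prop :=
  ∀ k : Fin m,
    (Finset.univ.filter fun j => C.d k j ≠ 0 ∧ C.grz j = C.grz k - 1).card +
      (Finset.univ.filter fun j => C.d j k ≠ 0 ∧ C.grz k = C.grz j - 1).card ≤ 1

/-- A degree-`(0,0)` chain map from `C` to `C'`: an `m × m'` matrix `f` over `F` whose
entry `f i j` vanishes unless `C'.grw j - C.grw i` and `C'.grz j - C.grz i` are both even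
and nonnegative, satisfying `d · f = f · d'`. -/
def IsChainMap (C : BigradedComplex F m) (C' : BigradedComplex F m')
    (f : Matrix (Fin m) (Fin m') F) : Prop :=
  (∀ i j, f i j ≠ 0 →
      Even (C'.grw j - C.grw i) ∧ 0 ≤ C'.grw j - C.grw i ∧
      Even (C'.grz j - C.grz i) ∧ 0 ≤ C'.grz j - C.grz i) ∧
  C.d * f = f * C'.d

/-- `C` and `C'` are isomorphic via a homogeneous change of basis: there are
degree-`(0,0)` chain maps `f : C → C'` and `g : C' → C` with `f · g` and `g · f`
equal to identity matrices. -/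
def Isomorphic (C : BigradedComplex F m) (C' : BigradedComplex F m') : Prop :=
  ∃ (f : Matrix (Fin m) (Fin m') F) (g : Matrix (Fin m') (Fin m) F),
    IsChainMap C C' f ∧ IsChainMap C' C g ∧ f * g = 1 ∧ g * f = 1

end BigradedComplex
namespace BigradedComplex

section General

variable {F : Type} [Field F] {m m' : ℕ}

/-- The bigrading of a generator, as a pair. -/
def gr (C : BigradedComplex F m) (i : Fin m) : ℤ × ℤ := (C.grw i, C.grz i)

/-- A degree-`(0,0)` map may have a nonzero entry from bigrading `s` to bigrading `t`. -/
abbrev AllowsMap (s t : ℤ × ℤ) : Prop :=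
  Even (t.1 - s.1) ∧ 0 ≤ t.1 - s.1 ∧ Even (t.2 - s.2) ∧ 0 ≤ t.2 - s.2

/-- A differential may have a nonzero entry from bigrading `s` to bigrading `t`. -/
abbrev AllowsArrow (s t : ℤ × ℤ) : Prop :=
  Odd (t.1 - s.1) ∧ -1 ≤ t.1 - s.1 ∧ -1 ≤ t.2 - s.2

/-- Among bigradings of generators of `C`, the only way to factor through an arrow and a
degree-`(0,0)` map from `s` to `t` is via `s` and `t` themselves. -/
def IsolatedBlock (C : BigradedComplex F m) (s t : ℤ × ℤ) : Prop :=
  ∀ l, (AllowsArrow s (C.gr l) → AllowsMap (C.gr l) t → C.gr l = t) ∧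
    (AllowsMap s (C.gr l) → AllowsArrow (C.gr l) t → C.gr l = s)

theorem IsChainMap.block_comm {C : BigradedComplex F m} {C' : BigradedComplex F m'}
    {f : Matrix (Fin m) (Fin m') F} (hf : IsChainMap C C' f) {s t : ℤ × ℤ}
    (hC : C.IsolatedBlock s t) (hC' : C'.IsolatedBlock s t)
    {i : Fin m} (hi : C.gr i = s) {k : Fin m'} (hk : C'.gr k = t) :
    ∑ l with C.gr l = t, C.d i l * f l k = ∑ l with C'.gr l = s, f i l * C'.d l k := by
  subst hi hk
  have h := congrFun (congrFun hf.2 i) k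
  rw [Matrix.mul_apply, Matrix.mul_apply] at h
  rw [Finset.sum_filter_of_ne, Finset.sum_filter_of_ne, h]
  · intro l _ hl
    exact (hC' l).2 (hf.1 i l (left_ne_zero_of_mul hl)) (C'.d_supp l k (right_ne_zero_of_mul hl))
  · intro l _ hl
    exact (hC l).1 (C.d_supp i l (left_ne_zero_of_mul hl)) (hf.1 l k (right_ne_zero_of_mul hl))

/-- A basis element is hit, in its own bigrading, by an isomorphism. -/
theorem exists_gr_eq_of_mul_eq_one {C : BigradedComplex F m} {C' : BigradedComplex F m'}
    {f : Matrix (Fin m) (Fin m') F} {g : Matrix (Fin m') (Fin m) F}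
    (hf : IsChainMap C C' f) (hg : IsChainMap C' C g) (hgf : g * f = 1) (i : Fin m') :
    ∃ k, C.gr k = C'.gr i ∧ g i k ≠ 0 := by
  have h := congrFun (congrFun hgf i) i
  rw [Matrix.mul_apply, Matrix.one_apply_eq] at h
  obtain ⟨k, -, hk⟩ := Finset.exists_ne_zero_of_sum_ne_zero (h.trans_ne one_ne_zero)
  refine ⟨k, ?_, left_ne_zero_of_mul hk⟩
  have h₁ := hg.1 i k (left_ne_zero_of_mul hk)
  have h₂ := hf.1 k i (right_ne_zero_of_mul hk)
  exact Prod.ext (by simp only [gr]; lia) (by simp only [gr]; lia)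

/-- The row sums of an isomorphism within a bigrading do not all vanish. -/
theorem exists_rowSum_ne_zero {C : BigradedComplex F m} {C' : BigradedComplex F m'}
    {f : Matrix (Fin m) (Fin m') F} {g : Matrix (Fin m') (Fin m) F}
    (hf : IsChainMap C C' f) (hg : IsChainMap C' C g) (hfg : f * g = 1) (hgf : g * f = 1)
    (i : Fin m) : ∃ k, C.gr k = C.gr i ∧ ∑ l with C'.gr l = C.gr i, f k l ≠ 0 := by
  obtain ⟨j, hj, -⟩ := exists_gr_eq_of_mul_eq_one hg hf hfg i
  by_contra! hzero
  have h : ∑ l with C'.gr l = C.gr i, (g * f) j l = 1 := by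
    rw [hgf, Finset.sum_eq_single_of_mem j (by simp [hj])
      fun l _ hl => Matrix.one_apply_ne hl.symm, Matrix.one_apply_eq]
  simp only [Matrix.mul_apply] at h
  rw [Finset.sum_comm] at h
  refine one_ne_zero (h.symm.trans (Finset.sum_eq_zero fun k _ => ?_))
  by_cases hk : C.gr k = C.gr i
  · rw [← Finset.mul_sum, hzero k hk, mul_zero]
  · refine Finset.sum_eq_zero fun l hl => ?_
    by_contra hne
    have hl := (Finset.mem_filter.1 hl).2
    have h₁ := hg.1 j k (left_ne_zero_of_mul hne)
    have h₂ := hf.1 k l (right_ne_zero_of_mul hne)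
    simp only [gr, Prod.mk.injEq] at hj hl hk
    lia

end General

theorem sum_zmod_two_eq_one {ι : Type} (S : Finset ι) (v : ι → ZMod 2)
    (hex : ∃ k ∈ S, v k ≠ 0) (huniq : ∀ j ∈ S, ∀ k ∈ S, v j ≠ 0 → v k ≠ 0 → j = k) :
    ∑ k ∈ S, v k = 1 := by
  obtain ⟨k, hk, hvk⟩ := hex
  rw [Finset.sum_eq_single k]
  · exact (by decide : ∀ x : ZMod 2, x ≠ 0 → x = 1) _ hvk
  · intro j hj hjk
    by_contra hvj
    exact hjk (huniq j hj k hk hvj hvk)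
  · exact fun h => absurd hk h

section Simplified

variable {F : Type} [Field F] {m : ℕ}

theorem VerticallySimplified.eq_of_ne_zero {C : BigradedComplex F m}
    (hC : C.VerticallySimplified) {i j k : Fin m}
    (hj : C.d i j ≠ 0) (hk : C.d i k ≠ 0)
    (hgj : C.grw j = C.grw i - 1) (hgk : C.grw k = C.grw i - 1) : j = k :=
  Finset.card_le_one.1 (le_trans (Nat.le_add_right _ _) (hC i)) j (by simp [hj, hgj])
    k (by simp [hk, hgk])

theorem HorizontallySimplified.eq_of_ne_zero {C : BigradedComplex F m}
    (hC : C.HorizontallySimplified) {i j k : Fin m}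
    (hj : C.d i j ≠ 0) (hk : C.d i k ≠ 0)
    (hgj : C.grz j = C.grz i - 1) (hgk : C.grz k = C.grz i - 1) : j = k :=
  Finset.card_le_one.1 (le_trans (Nat.le_add_right _ _) (hC i)) j (by simp [hj, hgj])
    k (by simp [hk, hgk])

end Simplified

/-- If `C'` is simplified in both directions and isomorphic to `C`, then along an injective
vertical or horizontal block of `C` the sums of the rows of the isomorphism correspond. -/
theorem sum_block_mul_rowSum {m m' : ℕ} {C : BigradedComplex (ZMod 2) m}
    {C' : BigradedComplex (ZMod 2) m'}
    {f : Matrix (Fin m) (Fin m') (ZMod 2)} {g : Matrix (Fin m') (Fin m) (ZMod 2)}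
    (hf : IsChainMap C C' f) (hg : IsChainMap C' C g) (hgf : g * f = 1)
    (hv : C'.VerticallySimplified) (hh : C'.HorizontallySimplified)
    {s t : ℤ × ℤ} (hst : t.1 = s.1 - 1 ∨ t.2 = s.2 - 1) (hC : C.IsolatedBlock s t)
    (hinj : ∀ v : Fin m → ZMod 2,
      (∀ k, C.gr k = t → ∑ l with C.gr l = s, v l * C.d l k = 0) → ∀ l, C.gr l = s → v l = 0)
    {i : Fin m} (hi : C.gr i = s) :
    ∑ l with C.gr l = t, C.d i l * ∑ k with C'.gr k = t, f l k =
      ∑ l with C'.gr l = s, f i l := by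
  have hC' : C'.IsolatedBlock s t := by
    intro l
    obtain ⟨k, hk, -⟩ := exists_gr_eq_of_mul_eq_one hf hg hgf l
    exact hk ▸ hC k
  have hrow : ∀ l, C'.gr l = s → ∑ k with C'.gr k = t, C'.d l k = 1 := by
    intro l hl
    apply sum_zmod_two_eq_one
    · by_contra! hzero
      obtain ⟨k, hk, hgk⟩ := exists_gr_eq_of_mul_eq_one hf hg hgf l
      refine hgk (hinj (g l) (fun k hk => ?_) k (hk.trans hl))
      rw [← hg.block_comm hC' hC hl hk]
      exact Finset.sum_eq_zero fun j hj => by rw [hzero j hj, zero_mul]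
    · intro j hj k hk hdj hdk
      have hj := (Finset.mem_filter.1 hj).2
      have hk := (Finset.mem_filter.1 hk).2
      subst hl
      rcases hst with h | h
      · exact hv.eq_of_ne_zero hdj hdk ((congrArg Prod.fst hj).trans h)
          ((congrArg Prod.fst hk).trans h)
      · exact hh.eq_of_ne_zero hdj hdk ((congrArg Prod.snd hj).trans h)
          ((congrArg Prod.snd hk).trans h)
  simp only [Finset.mul_sum]
  rw [Finset.sum_comm]
  rw [Finset.sum_congr rfl fun k hk =>
    hf.block_comm hC hC' hi (Finset.mem_filter.1 hk).2]
  rw [Finset.sum_comm]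
  refine Finset.sum_congr rfl fun l hl => ?_
  rw [← Finset.mul_sum, hrow l (Finset.mem_filter.1 hl).2, mul_one]

/-- The entries of the differential of `twistedSquare`. -/
def twistedSquareEntry : Fin 10 → Fin 10 → ZMod 2 :=
  ![![0, 0, 1, 0, 0, 1, 1, 0, 0, 0],
    ![0, 0, 0, 1, 1, 1, 0, 1, 0, 0],
    ![0, 0, 0, 0, 0, 0, 0, 0, 1, 0],
    ![0, 0, 0, 0, 0, 0, 0, 0, 0, 1],
    ![0, 0, 0, 0, 0, 0, 0, 0, 1, 0],
    ![0, 0, 0, 0, 0, 0, 0, 0, 0, 1],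
    ![0, 0, 0, 0, 0, 0, 0, 0, 1, 1],
    ![0, 0, 0, 0, 0, 0, 0, 0, 1, 0],
    ![0, 0, 0, 0, 0, 0, 0, 0, 0, 0],
    ![0, 0, 0, 0, 0, 0, 0, 0, 0, 0]]

/-- The `U`-gradings of `twistedSquare`. -/
def twistedSquareW : Fin 10 → ℤ := ![-2, -2, 1, 1, -3, -3, -1, -1, 0, 0]

/-- The `V`-gradings of `twistedSquare`. -/
def twistedSquareZ : Fin 10 → ℤ := ![-2, -2, -3, -3, 1, 1, -1, -1, 0, 0]

set_option maxRecDepth 10000 in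
theorem twistedSquareEntry_supp (i j : Fin 10) (h : twistedSquareEntry i j ≠ 0) :
    (twistedSquareW j - twistedSquareW i) % 2 = 1 ∧ -1 ≤ twistedSquareW j - twistedSquareW i ∧
      -1 ≤ twistedSquareZ j - twistedSquareZ i := by
  revert i j
  decide

set_option maxRecDepth 10000 in
/-- A square of side two in which every corner is doubled, with holonomy of order three around
the square; two further generators, in the middle, make the differential square to zero. -/
def twistedSquare : BigradedComplex (ZMod 2) 10 where
  grw := twistedSquareW
  grz := twistedSquareZ
  parity := by decide
  d := Matrix.of twistedSquareEntry
  d_sq := by decide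
  d_supp i j h := by
    rw [Int.odd_iff]
    exact twistedSquareEntry_supp i j h

theorem twistedSquare_filter_source :
    (Finset.univ.filter fun i => twistedSquare.gr i = (-2, -2)) = {0, 1} := by decide

theorem twistedSquare_filter_right :
    (Finset.univ.filter fun i => twistedSquare.gr i = (1, -3)) = {2, 3} := by decide

theorem twistedSquare_filter_up :
    (Finset.univ.filter fun i => twistedSquare.gr i = (-3, 1)) = {4, 5} := by decide

theorem twistedSquare_filter_sink :
    (Finset.univ.filter fun i => twistedSquare.gr i = (0, 0)) = {8, 9} := by decide

set_option maxRecDepth 10000 in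
theorem twistedSquare_reduced : twistedSquare.Reduced := by
  have h : ∀ i j, twistedSquareW j = twistedSquareW i - 1 →
      twistedSquareZ j = twistedSquareZ i - 1 → twistedSquareEntry i j = 0 := by
    decide
  exact h

theorem twistedSquare_isolated_source_right : twistedSquare.IsolatedBlock (-2, -2) (1, -3) := by
  simp only [IsolatedBlock, AllowsArrow, Int.odd_iff]; decide

theorem twistedSquare_isolated_source_up : twistedSquare.IsolatedBlock (-2, -2) (-3, 1) := by
  simp only [IsolatedBlock, AllowsArrow, Int.odd_iff]; decide

theorem twistedSquare_isolated_right_sink : twistedSquare.IsolatedBlock (1, -3) (0, 0) := by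
  simp only [IsolatedBlock, AllowsArrow, Int.odd_iff]; decide

theorem twistedSquare_isolated_up_sink : twistedSquare.IsolatedBlock (-3, 1) (0, 0) := by
  simp only [IsolatedBlock, AllowsArrow, Int.odd_iff]; decide

theorem twistedSquare_d (i j : Fin 10) : twistedSquare.d i j = twistedSquareEntry i j := rfl

theorem twistedSquare_injective_source_right (v : Fin 10 → ZMod 2)
    (hv : ∀ k, twistedSquare.gr k = (1, -3) →
      ∑ l with twistedSquare.gr l = (-2, -2), v l * twistedSquare.d l k = 0)
    (l : Fin 10) (hl : twistedSquare.gr l = (-2, -2)) : v l = 0 := by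
  have h₀ := hv 2 rfl
  have h₁ := hv 3 rfl
  have hl : l ∈ ({0, 1} : Finset (Fin 10)) := by simp [← twistedSquare_filter_source, hl]
  simp [twistedSquare_filter_source, twistedSquare_d, twistedSquareEntry] at h₀ h₁ hl
  rcases hl with rfl | rfl <;> simp_all

theorem twistedSquare_injective_source_up (v : Fin 10 → ZMod 2)
    (hv : ∀ k, twistedSquare.gr k = (-3, 1) →
      ∑ l with twistedSquare.gr l = (-2, -2), v l * twistedSquare.d l k = 0)
    (l : Fin 10) (hl : twistedSquare.gr l = (-2, -2)) : v l = 0 := by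
  have h₀ := hv 4 rfl
  have h₁ := hv 5 rfl
  have hl : l ∈ ({0, 1} : Finset (Fin 10)) := by simp [← twistedSquare_filter_source, hl]
  simp [twistedSquare_filter_source, twistedSquare_d, twistedSquareEntry] at h₀ h₁ hl
  rcases hl with rfl | rfl <;> simp_all

theorem twistedSquare_injective_right_sink (v : Fin 10 → ZMod 2)
    (hv : ∀ k, twistedSquare.gr k = (0, 0) →
      ∑ l with twistedSquare.gr l = (1, -3), v l * twistedSquare.d l k = 0)
    (l : Fin 10) (hl : twistedSquare.gr l = (1, -3)) : v l = 0 := by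
  have h₀ := hv 8 rfl
  have h₁ := hv 9 rfl
  have hl : l ∈ ({2, 3} : Finset (Fin 10)) := by simp [← twistedSquare_filter_right, hl]
  simp [twistedSquare_filter_right, twistedSquare_d, twistedSquareEntry] at h₀ h₁ hl
  rcases hl with rfl | rfl <;> simp_all

theorem twistedSquare_injective_up_sink (v : Fin 10 → ZMod 2)
    (hv : ∀ k, twistedSquare.gr k = (0, 0) →
      ∑ l with twistedSquare.gr l = (-3, 1), v l * twistedSquare.d l k = 0)
    (l : Fin 10) (hl : twistedSquare.gr l = (-3, 1)) : v l = 0 := by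
  have h₀ := hv 8 rfl
  have h₁ := hv 9 rfl
  have hl : l ∈ ({4, 5} : Finset (Fin 10)) := by simp [← twistedSquare_filter_up, hl]
  simp [twistedSquare_filter_up, twistedSquare_d, twistedSquareEntry] at h₀ h₁ hl
  rcases hl with rfl | rfl <;> simp_all

end BigradedComplex

open BigradedComplex in
/-- There exists a reduced matrix-model bigraded complex over the two-element field
`𝔽₂ = ℤ/2ℤ` that is not isomorphic, via a homogeneous change of basis, to any
matrix-model bigraded complex that is simultaneously vertically simplified and
horizontally simplified. -/
theorem exists_no_simultaneously_simplified_basis :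
    ∃ (m : ℕ) (C : BigradedComplex (ZMod 2) m), C.Reduced ∧
      ∀ (m' : ℕ) (C' : BigradedComplex (ZMod 2) m'),
        C.Isomorphic C' →
          ¬(C'.VerticallySimplified ∧ C'.HorizontallySimplified) := by
  refine ⟨10, twistedSquare, twistedSquare_reduced, ?_⟩
  rintro m' C' ⟨f, g, hf, hg, hfg, hgf⟩ ⟨hv, hh⟩
  have hsr {i} := sum_block_mul_rowSum (i := i) hf hg hgf hv hh (by decide)
    twistedSquare_isolated_source_right twistedSquare_injective_source_right
  have hsu {i} := sum_block_mul_rowSum (i := i) hf hg hgf hv hh (by decide)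
    twistedSquare_isolated_source_up twistedSquare_injective_source_up
  have hrs {i} := sum_block_mul_rowSum (i := i) hf hg hgf hv hh (by decide)
    twistedSquare_isolated_right_sink twistedSquare_injective_right_sink
  have hus {i} := sum_block_mul_rowSum (i := i) hf hg hgf hv hh (by decide)
    twistedSquare_isolated_up_sink twistedSquare_injective_up_sink
  obtain ⟨k, hk, hne⟩ := exists_rowSum_ne_zero hf hg hfg hgf 0
  have hk : k ∈ ({0, 1} : Finset (Fin 10)) := by
    rw [← twistedSquare_filter_source]
    exact Finset.mem_filter.2 ⟨Finset.mem_univ k, hk⟩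
  have h₀ := @hsr 0 rfl
  have h₁ := @hsr 1 rfl
  have h₂ := @hsu 0 rfl
  have h₃ := @hsu 1 rfl
  have h₄ := @hrs 2 rfl
  have h₅ := @hrs 3 rfl
  have h₆ := @hus 4 rfl
  have h₇ := @hus 5 rfl
  simp [twistedSquare_filter_right, twistedSquare_filter_up, twistedSquare_filter_sink,
    twistedSquare_d, twistedSquareEntry] at h₀ h₁ h₂ h₃ h₄ h₅ h₆ h₇
  change ∑ l with C'.gr l = (-2, -2), f k l ≠ 0 at hne
  simp at hk
  rcases hk with rfl | rfl <;> grind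
end
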